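/- arXiv:2206.04660 — 2 statements merged into one kernel-verified Lean document; each statement's English description precedes it below -/
import Mathlib

section
/- Let 21 ∈ S_2 denote the inversion pattern. Then ξ is CC with respect to 21, t_{21}(ξ) = 1/2, α_{21}(ξ) = 1, and for every δ ∈ (1/2,1) the set of minimizers satisfies 𝒢(21,ξ,δ) = { ((1+√(2δ−1))/2)·ξ₁₁ + ((1−√(2δ−1))/2)·ξ₂₂ , ((1−√(2δ−1))/2)·ξ₁₁ + ((1+√(2δ−1))/2)·ξ₂₂ }. Moreover, for every δ ∈ (1/2,1) the set 𝒪(𝒢(21,ξ,δ)) := {𝒪(ν) : ν ∈ 𝒢(21,ξ,δ)} has exactly two elements. -/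
open MeasureTheory Filter Topology
open scoped ENNReal

noncomputable section

/-- The plane `ℝ²`, carrier for measures on the unit square. -/
abbrev Ω2 : Type := ℝ × ℝ

/-- The unit square `[0,1]² ⊆ ℝ²`. -/
def unitSq : Set Ω2 := Set.Icc (0 : ℝ) 1 ×ˢ Set.Icc (0 : ℝ) 1

/-- Lebesgue measure on the unit square. -/
def lebSq : Measure Ω2 := volume.restrict unitSq

/-- `𝒫`: Borel probability measures concentrated on the unit square. -/
def Pcal : Set (ProbabilityMeasure Ω2) := {μ | (μ : Measure Ω2) unitSq = 1}

/-- `ℳ`: members of `𝒫` whose two coordinate marginals are atomless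
(equivalently, have continuous CDFs). -/
def Mcal : Set (ProbabilityMeasure Ω2) :=
  {μ | μ ∈ Pcal ∧ (∀ x : ℝ, (μ : Measure Ω2).map Prod.fst {x} = 0) ∧
      ∀ y : ℝ, (μ : Measure Ω2).map Prod.snd {y} = 0}

/-- The uniform distribution on `[0,1]`. -/
def unif01 : Measure ℝ := volume.restrict (Set.Icc (0 : ℝ) 1)

/-- `ℳ̃`: permutons, i.e. members of `𝒫` with both marginals uniform on `[0,1]`. -/
def Mtilde : Set (ProbabilityMeasure Ω2) :=
  {μ | μ ∈ Pcal ∧ (μ : Measure Ω2).map Prod.fst = unif01 ∧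
      (μ : Measure Ω2).map Prod.snd = unif01}

open scoped Classical in
/-- `h_σ`: indicator that the `k` points induce the pattern `σ`. -/
def hPat {k : ℕ} (σ : Equiv.Perm (Fin k)) (z : Fin k → Ω2) : ℝ :=
  if ∃ τ : Equiv.Perm (Fin k),
      StrictMono (fun i => (z (τ i)).1) ∧ StrictMono (fun i => (z (τ (σ⁻¹ i))).2)
  then 1 else 0

/-- Pattern density `t_σ(ν) = ∫ h_σ dν^{⊗k}`. -/
def tPat {k : ℕ} (σ : Equiv.Perm (Fin k)) (ν : Measure Ω2) : ℝ :=
  ∫ z, hPat σ z ∂(Measure.pi fun _ : Fin k => ν)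

open scoped Classical in
/-- The permutation induced by `n` labelled points of `ℝ²` (junk value `1` if the
coordinates are not in generic position). -/
def inducedPerm {n : ℕ} (z : Fin n → Ω2) : Equiv.Perm (Fin n) :=
  if h : ∃ σ : Equiv.Perm (Fin n), hPat σ z = 1 then h.choose else 1

/-- Empirical measure `Em(π) = (1/n) ∑ δ_{(i/n, π(i)/n)}` of a permutation, as a measure. -/
def EmM {n : ℕ} (π : Equiv.Perm (Fin n)) : Measure Ω2 :=
  (n : ℝ≥0∞)⁻¹ • ∑ i : Fin n, Measure.dirac ((((i : ℕ) + 1 : ℝ)) / n, (((π i : ℕ) + 1 : ℝ)) / n)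

open scoped Classical in
/-- Empirical measure of a permutation as a probability measure (junk value for `n = 0`). -/
def EmP {n : ℕ} (π : Equiv.Perm (Fin n)) : ProbabilityMeasure Ω2 :=
  if h : IsProbabilityMeasure (EmM π) then ⟨EmM π, h⟩
  else ⟨Measure.dirac 0, by infer_instance⟩

/-- `t_σ(π) := t_σ(Em(π))`. -/
def tPerm {k n : ℕ} (σ : Equiv.Perm (Fin k)) (π : Equiv.Perm (Fin n)) : ℝ := tPat σ (EmM π)

open scoped Classical in
/-- Kullback–Leibler divergence `D(ν|μ) ∈ [0,∞]`; for probability measures with `ν ≪ μ`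
it equals `∫ log(dν/dμ) dν`, written here through the nonnegative integrand
`g log g + 1 - g` of the density `g = dν/dμ` (the correction `∫ (1-g) dμ = 0`). -/
def KL (ν μ : Measure Ω2) : ℝ≥0∞ :=
  if ν ≪ μ then
    ∫⁻ z, ENNReal.ofReal ((ν.rnDeriv μ z).toReal * Real.log ((ν.rnDeriv μ z).toReal)
      + 1 - (ν.rnDeriv μ z).toReal) ∂μ
  else ∞

/-- CDF of the first marginal. -/
def cdfX (μ : Measure Ω2) (x : ℝ) : ℝ := (μ {p : Ω2 | p.1 ≤ x}).toReal

/-- CDF of the second marginal. -/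
def cdfY (μ : Measure Ω2) (y : ℝ) : ℝ := (μ {p : Ω2 | p.2 ≤ y}).toReal

/-- The map `𝒪`: pushforward of `μ` under `(x,y) ↦ (F₁(x), F₂(y))`. -/
def Omap (μ : Measure Ω2) : Measure Ω2 := μ.map fun p => (cdfX μ p.1, cdfY μ p.2)

/-- The product measure `μ^{⊗n}` governing `n` i.i.d. samples. -/
def pmeas (μ : Measure Ω2) (n : ℕ) : Measure (Fin n → Ω2) := Measure.pi fun _ => μ

/-- Log-partition function `F_n(σ,μ,θ) = log E[exp(nθ t_σ(π_{n,μ}))]`. -/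
def Fn {k : ℕ} (σ : Equiv.Perm (Fin k)) (μ : Measure Ω2) (θ : ℝ) (n : ℕ) : ℝ :=
  Real.log (∫ z, Real.exp (n * θ * tPerm σ (inducedPerm z)) ∂pmeas μ n)

/-- The Gibbs measure `Q_{n,σ,μ,θ}` on `([0,1]²)ⁿ`. -/
def Qgibbs {k : ℕ} (σ : Equiv.Perm (Fin k)) (μ : Measure Ω2) (θ : ℝ) (n : ℕ) :
    Measure (Fin n → Ω2) :=
  (pmeas μ n).withDensity fun z =>
    ENNReal.ofReal (Real.exp (n * θ * tPerm σ (inducedPerm z) - Fn σ μ θ n))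

/-- `F(σ,μ,θ) = sup_{ν ∈ ℳ} { θ t_σ(ν) − D(ν|μ) }`, valued in `EReal`. -/
def Fsup {k : ℕ} (σ : Equiv.Perm (Fin k)) (μ : Measure Ω2) (θ : ℝ) : EReal :=
  ⨆ ν ∈ Mcal, (((θ * tPat σ (ν : Measure Ω2) : ℝ) : EReal) - ((KL (↑ν) μ : ℝ≥0∞) : EReal))

/-- `ℱ(σ,μ,θ)`: the set of maximizers of `ν ↦ θ t_σ(ν) − D(ν|μ)` over `ℳ`. -/
def Fset {k : ℕ} (σ : Equiv.Perm (Fin k)) (μ : Measure Ω2) (θ : ℝ) :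
    Set (ProbabilityMeasure Ω2) :=
  {ν | ν ∈ Mcal ∧
    (((θ * tPat σ (ν : Measure Ω2) : ℝ) : EReal) - ((KL (↑ν) μ : ℝ≥0∞) : EReal)) = Fsup σ μ θ}

/-- `G(σ,μ,δ) = inf { D(ν|μ) : ν ∈ ℳ, t_σ(ν) ≥ δ }`. -/
def Gfun {k : ℕ} (σ : Equiv.Perm (Fin k)) (μ : Measure Ω2) (δ : ℝ) : ℝ≥0∞ :=
  ⨅ ν ∈ {ν : ProbabilityMeasure Ω2 | ν ∈ Mcal ∧ δ ≤ tPat σ (ν : Measure Ω2)}, KL (↑ν) μ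

/-- `𝒢(σ,μ,δ)`: the set of minimizers in the definition of `G(σ,μ,δ)`. -/
def Gset {k : ℕ} (σ : Equiv.Perm (Fin k)) (μ : Measure Ω2) (δ : ℝ) :
    Set (ProbabilityMeasure Ω2) :=
  {ν | (ν ∈ Mcal ∧ δ ≤ tPat σ (ν : Measure Ω2)) ∧ KL (↑ν) μ = Gfun σ μ δ}

/-- `α_σ(μ) = inf {δ : G(σ,μ,δ) = ∞}`. -/
def alphaSig {k : ℕ} (σ : Equiv.Perm (Fin k)) (μ : Measure Ω2) : ℝ :=
  sInf {δ : ℝ | Gfun σ μ δ = ∞}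

/-- `μ` is conditionally constant (CC) with respect to a pattern `σ` of size `k+1`:
the conditional probability `P(π_{X,Y} = σ | (X₁,Y₁))`, which for i.i.d. samples equals
`z ↦ ∫ h_σ(z, w) dμ^{⊗k}(w)`, is `μ`-a.s. equal to a constant `c ∈ [0,1]`. -/
def IsCC {k : ℕ} (σ : Equiv.Perm (Fin (k + 1))) (μ : Measure Ω2) : Prop :=
  ∃ c ∈ Set.Icc (0 : ℝ) 1, ∀ᵐ z ∂μ,
    (∫ w : Fin k → Ω2, hPat σ (Fin.cons z w) ∂pmeas μ k) = c

/-- The inversion pattern `21 ∈ S₂`. -/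
def inv2 : Equiv.Perm (Fin 2) := Equiv.swap 0 1

/-- Lévy–Prokhorov (extended) distance between measures on `ℝ²`. -/
def dLPE (μ ν : Measure Ω2) : ℝ≥0∞ := levyProkhorovEDist μ ν

/-- The topological support of a measure: the points whose every open neighbourhood
has positive measure. -/
def msupport (μ : Measure Ω2) : Set Ω2 :=
  {z | ∀ U : Set Ω2, IsOpen U → z ∈ U → 0 < μ U}


/-- `ξ₁₁`: the law of `(X, 1/2 − X)` with `X ~ Unif[0,1/2]`. -/
def xi11 : Measure Ω2 :=
  ((2 : ℝ≥0∞) • volume.restrict (Set.Icc (0 : ℝ) (1/2))).map fun x => (x, 1/2 - x)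

/-- `ξ₂₂`: the law of `(X, 3/2 − X)` with `X ~ Unif[1/2,1]`. -/
def xi22 : Measure Ω2 :=
  ((2 : ℝ≥0∞) • volume.restrict (Set.Icc (1/2 : ℝ) 1)).map fun x => (x, 3/2 - x)

/-- The permuton `ξ = (ξ₁₁ + ξ₂₂)/2`. -/
def xiM : Measure Ω2 := (2⁻¹ : ℝ≥0∞) • xi11 + (2⁻¹ : ℝ≥0∞) • xi22

/-! ### The two branches of the support of `ξ` -/

/-- The open antidiagonal segment in the lower left quarter of the unit square. -/
def lowerBranch : Set Ω2 := {z | 0 < z.1 ∧ z.1 < 1/2 ∧ z.1 + z.2 = 1/2}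

/-- The open antidiagonal segment in the upper right quarter of the unit square. -/
def upperBranch : Set Ω2 := {z | 1/2 < z.1 ∧ z.1 < 1 ∧ z.1 + z.2 = 3/2}

/-- The mixture `a • ξ₁₁ + (1 - a) • ξ₂₂`. -/
def mixXi (a : ℝ) : Measure Ω2 :=
  ENNReal.ofReal a • xi11 + ENNReal.ofReal (1 - a) • xi22

lemma measurableSet_lowerBranch : MeasurableSet lowerBranch := by
  unfold lowerBranch
  measurability

lemma disjoint_branches {z : Ω2} (h : z ∈ upperBranch) : z ∉ lowerBranch := by
  rintro ⟨-, h', -⟩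
  have := h.1
  linarith

instance : IsProbabilityMeasure xi11 := by
  refine ⟨?_⟩
  rw [xi11, Measure.map_apply (by fun_prop) .univ]
  simp only [Set.preimage_univ, Measure.smul_apply, Measure.restrict_apply_univ, Real.volume_Icc,
    smul_eq_mul]
  rw [← ENNReal.ofReal_ofNat, ← ENNReal.ofReal_mul (by norm_num)]
  norm_num

instance : IsProbabilityMeasure xi22 := by
  refine ⟨?_⟩
  rw [xi22, Measure.map_apply (by fun_prop) .univ]
  simp only [Set.preimage_univ, Measure.smul_apply, Measure.restrict_apply_univ, Real.volume_Icc,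
    smul_eq_mul]
  rw [← ENNReal.ofReal_ofNat, ← ENNReal.ofReal_mul (by norm_num)]
  norm_num

lemma isProbabilityMeasure_mixXi {a : ℝ} (ha : 0 ≤ a) (ha' : a ≤ 1) :
    IsProbabilityMeasure (mixXi a) := by
  refine ⟨?_⟩
  simp only [mixXi, Measure.add_apply, Measure.smul_apply, measure_univ, smul_eq_mul, mul_one]
  rw [← ENNReal.ofReal_add ha (by linarith)]
  simp

lemma xiM_eq_mixXi : xiM = mixXi (1/2) := by
  have h : (2⁻¹ : ℝ≥0∞) = ENNReal.ofReal (1/2) := by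
    rw [one_div, ENNReal.ofReal_inv_of_pos (by norm_num)]
    simp
  rw [mixXi, xiM, h]
  norm_num

instance : IsProbabilityMeasure xiM :=
  xiM_eq_mixXi ▸ isProbabilityMeasure_mixXi (by norm_num) (by norm_num)

lemma ae_xi11_of_forall {p : Ω2 → Prop}
    (h : ∀ᵐ x : ℝ, 0 < x → x < 1/2 → p (x, 1/2 - x)) : ∀ᵐ z ∂xi11, p z := by
  have hm : Measurable fun x : ℝ => (x, 1/2 - x) := by fun_prop
  have he : MeasurableEmbedding fun x : ℝ => (x, 1/2 - x) :=
    hm.measurableEmbedding fun x y hxy => (Prod.ext_iff.1 hxy).1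
  rw [xi11, he.ae_map_iff]
  refine Measure.ae_smul_measure ?_ _
  rw [ae_restrict_iff' measurableSet_Icc]
  filter_upwards [h, Measure.ae_ne volume (0 : ℝ), Measure.ae_ne volume (1/2 : ℝ)]
    with x hx h0 h1 hI
  exact hx (lt_of_le_of_ne hI.1 (Ne.symm h0)) (lt_of_le_of_ne hI.2 h1)

lemma ae_xi22_of_forall {p : Ω2 → Prop}
    (h : ∀ᵐ x : ℝ, 1/2 < x → x < 1 → p (x, 3/2 - x)) : ∀ᵐ z ∂xi22, p z := by
  have hm : Measurable fun x : ℝ => (x, 3/2 - x) := by fun_prop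
  have he : MeasurableEmbedding fun x : ℝ => (x, 3/2 - x) :=
    hm.measurableEmbedding fun x y hxy => (Prod.ext_iff.1 hxy).1
  rw [xi22, he.ae_map_iff]
  refine Measure.ae_smul_measure ?_ _
  rw [ae_restrict_iff' measurableSet_Icc]
  filter_upwards [h, Measure.ae_ne volume (1/2 : ℝ), Measure.ae_ne volume (1 : ℝ)]
    with x hx h0 h1 hI
  exact hx (lt_of_le_of_ne hI.1 (Ne.symm h0)) (lt_of_le_of_ne hI.2 h1)

lemma ae_mem_lowerBranch : ∀ᵐ z ∂xi11, z ∈ lowerBranch :=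
  ae_xi11_of_forall (.of_forall fun x h0 h1 => ⟨h0, h1, by simp⟩)

lemma ae_mem_upperBranch : ∀ᵐ z ∂xi22, z ∈ upperBranch :=
  ae_xi22_of_forall (.of_forall fun x h0 h1 => ⟨h0, h1, by simp⟩)

lemma ae_xiM_of_ae {p : Ω2 → Prop} (h₁ : ∀ᵐ z ∂xi11, p z) (h₂ : ∀ᵐ z ∂xi22, p z) :
    ∀ᵐ z ∂xiM, p z :=
  ae_add_measure_iff.2 ⟨Measure.ae_smul_measure h₁ _, Measure.ae_smul_measure h₂ _⟩

lemma ae_mem_branches : ∀ᵐ z ∂xiM, z ∈ lowerBranch ∨ z ∈ upperBranch :=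
  ae_xiM_of_ae (ae_mem_lowerBranch.mono fun _ => Or.inl)
    (ae_mem_upperBranch.mono fun _ => Or.inr)

lemma ae_fst_ne (x : ℝ) : ∀ᵐ z ∂xiM, z.1 ≠ x :=
  ae_xiM_of_ae
    (ae_xi11_of_forall ((Measure.ae_ne volume x).mono fun _ h _ _ => h))
    (ae_xi22_of_forall ((Measure.ae_ne volume x).mono fun _ h _ _ => h))

lemma ae_snd_ne (y : ℝ) : ∀ᵐ z ∂xiM, z.2 ≠ y :=
  ae_xiM_of_ae
    (ae_xi11_of_forall ((Measure.ae_ne volume (1/2 - y)).mono fun x h _ _ h' =>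
      h (by simp only at h'; linarith)))
    (ae_xi22_of_forall ((Measure.ae_ne volume (3/2 - y)).mono fun x h _ _ h' =>
      h (by simp only at h'; linarith)))

lemma mem_Mcal_of_absolutelyContinuous {ν : ProbabilityMeasure Ω2}
    (h : (ν : Measure Ω2) ≪ xiM) : ν ∈ Mcal := by
  refine ⟨?_, fun x => ?_, fun y => ?_⟩
  · refine prob_compl_eq_zero_iff (measurableSet_Icc.prod measurableSet_Icc) |>.1 ?_
    change ∀ᵐ z ∂(ν : Measure Ω2), z ∈ unitSq
    filter_upwards [h.ae_le ae_mem_branches] with z hz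
    simp only [unitSq, Set.mem_prod, Set.mem_Icc]
    rcases hz with ⟨h0, h1, h2⟩ | ⟨h0, h1, h2⟩ <;>
      refine ⟨⟨?_, ?_⟩, ?_, ?_⟩ <;> linarith
  · rw [Measure.map_apply measurable_fst (measurableSet_singleton x)]
    simpa [Set.preimage] using ae_iff.1 (h.ae_le (ae_fst_ne x))
  · rw [Measure.map_apply measurable_snd (measurableSet_singleton y)]
    simpa [Set.preimage] using ae_iff.1 (h.ae_le (ae_snd_ne y))

/-! ### The density of inversions -/

/-- The set of pairs of points forming an inversion. -/
def inversionSet : Set (Ω2 × Ω2) :=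
  {q | (q.1.1 < q.2.1 ∧ q.2.2 < q.1.2) ∨ (q.2.1 < q.1.1 ∧ q.1.2 < q.2.2)}

lemma measurableSet_inversionSet : MeasurableSet inversionSet := by
  unfold inversionSet
  measurability

lemma hPat_inv2 (z : Fin 2 → Ω2) :
    hPat inv2 z = inversionSet.indicator 1 (z 0, z 1) := by
  have hτ : ∀ τ : Equiv.Perm (Fin 2), τ = 1 ∨ τ = Equiv.swap 0 1 := by decide
  have hiff : (∃ τ : Equiv.Perm (Fin 2), StrictMono (fun i => (z (τ i)).1) ∧
      StrictMono (fun i => (z (τ (inv2⁻¹ i))).2)) ↔ (z 0, z 1) ∈ inversionSet := by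
    simp only [Fin.strictMono_iff_lt_succ, inv2, inversionSet]
    constructor
    · rintro ⟨τ, h₁, h₂⟩
      rcases hτ τ with rfl | rfl
      · exact Or.inl ⟨by simpa using h₁, by simpa using h₂⟩
      · exact Or.inr ⟨by simpa using h₁, by simpa using h₂⟩
    · rintro (⟨h₁, h₂⟩ | ⟨h₁, h₂⟩)
      · exact ⟨1, by simpa using h₁, by simpa using h₂⟩
      · exact ⟨Equiv.swap 0 1, by simpa using h₁, by simpa using h₂⟩
  simp only [hPat, hiff, Set.indicator, Pi.one_apply]
  congr 1
  exact propext hiff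

lemma integral_ite_lowerBranch {ν : Measure Ω2} [IsProbabilityMeasure ν]
    [DecidablePred (· ∈ lowerBranch)] (u v : ℝ) :
    ∫ z, (if z ∈ lowerBranch then u else v) ∂ν
      = ν.real lowerBranch * u + (1 - ν.real lowerBranch) * v := by
  have h : (fun z => if z ∈ lowerBranch then u else v)
      = fun z => lowerBranch.indicator (fun _ => u - v) z + v := by
    ext z
    by_cases hz : z ∈ lowerBranch <;> simp [hz]
  rw [h, integral_add ((integrable_const _).indicator measurableSet_lowerBranch)
    (integrable_const _), integral_indicator_const _ measurableSet_lowerBranch]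
  simp only [integral_const, probReal_univ, smul_eq_mul]
  ring

section
variable {ν : Measure Ω2} [IsProbabilityMeasure ν]

open scoped Classical in
lemma ae_measureReal_inversions (h : ν ≪ xiM) :
    ∀ᵐ z ∂ν, ν.real {w | (z, w) ∈ inversionSet} =
      if z ∈ lowerBranch then ν.real lowerBranch else 1 - ν.real lowerBranch := by
  filter_upwards [h.ae_le ae_mem_branches] with z hz
  by_cases hL : z ∈ lowerBranch
  · rw [if_pos hL]
    refine measureReal_congr ?_
    filter_upwards [h.ae_le ae_mem_branches, h.ae_le (ae_fst_ne z.1)] with w hw hne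
    refine propext ⟨fun hi => ?_, fun hi => ?_⟩
    · refine hw.resolve_right fun hU => ?_
      obtain ⟨a1, a2, a3⟩ := hL
      obtain ⟨b1, b2, b3⟩ := hU
      rcases hi with ⟨c, d⟩ | ⟨c, d⟩ <;> simp only at c d <;> linarith
    · obtain ⟨a1, a2, a3⟩ := hL
      obtain ⟨b1, b2, b3⟩ := hi
      rcases lt_or_gt_of_ne hne with hlt | hlt
      · exact Or.inr ⟨hlt, by simp only; linarith⟩
      · exact Or.inl ⟨hlt, by simp only; linarith⟩
  · rw [if_neg hL, ← probReal_compl_eq_one_sub measurableSet_lowerBranch]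
    refine measureReal_congr ?_
    obtain ⟨a1, a2, a3⟩ := hz.resolve_left hL
    filter_upwards [h.ae_le ae_mem_branches, h.ae_le (ae_fst_ne z.1)] with w hw hne
    refine propext ⟨fun hi hw' => ?_, fun hi => ?_⟩
    · obtain ⟨b1, b2, b3⟩ := hw'
      rcases hi with ⟨c, d⟩ | ⟨c, d⟩ <;> simp only at c d <;> linarith
    · obtain ⟨b1, b2, b3⟩ := hw.resolve_left hi
      rcases lt_or_gt_of_ne hne with hlt | hlt
      · exact Or.inr ⟨hlt, by simp only; linarith⟩
      · exact Or.inl ⟨hlt, by simp only; linarith⟩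

lemma tPat_inv2_eq (h : ν ≪ xiM) :
    tPat inv2 ν = ν.real lowerBranch ^ 2 + (1 - ν.real lowerBranch) ^ 2 := by
  classical
  have h₁ : tPat inv2 ν = ∫ q, inversionSet.indicator (1 : Ω2 × Ω2 → ℝ) q ∂ν.prod ν := by
    rw [← (measurePreserving_finTwoArrow ν).integral_comp (MeasurableEquiv.measurableEmbedding _)]
    simp only [tPat, hPat_inv2]
    rfl
  have h₂ (z : Ω2) : ∫ w, inversionSet.indicator (1 : Ω2 × Ω2 → ℝ) (z, w) ∂ν
      = ν.real {w | (z, w) ∈ inversionSet} :=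
    integral_indicator_one (measurable_prodMk_left measurableSet_inversionSet)
  rw [h₁, integral_prod _ ((integrable_const 1).indicator measurableSet_inversionSet)]
  simp only [h₂]
  rw [integral_congr_ae (ae_measureReal_inversions h)]
  rw [integral_ite_lowerBranch]
  ring

end

lemma tPat_le_one {k : ℕ} (σ : Equiv.Perm (Fin k)) (ν : Measure Ω2) [IsProbabilityMeasure ν] :
    tPat σ ν ≤ 1 := by
  have h (z : Fin k → Ω2) : ‖hPat σ z‖ ≤ 1 := by
    unfold hPat
    split_ifs <;> simp
  have h' : ‖tPat σ ν‖ ≤ 1 := by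
    simpa [tPat] using norm_integral_le_of_norm_le_const
      (μ := Measure.pi fun _ : Fin k => ν) (.of_forall h)
  exact (Real.le_norm_self _).trans h'

/-! ### Mixtures of the two branches -/

/-- The density of `mixXi a` with respect to `ξ`. -/
def mixDensity (a : ℝ) : Ω2 → ℝ≥0∞ :=
  lowerBranch.indicator (fun _ => ENNReal.ofReal (2 * a)) +
    lowerBranchᶜ.indicator (fun _ => ENNReal.ofReal (2 * (1 - a)))

lemma measurable_mixDensity (a : ℝ) : Measurable (mixDensity a) :=
  (measurable_const.indicator measurableSet_lowerBranch).add
    (measurable_const.indicator measurableSet_lowerBranch.compl)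

lemma mixDensity_of_mem {a : ℝ} {z : Ω2} (hz : z ∈ lowerBranch) :
    mixDensity a z = ENNReal.ofReal (2 * a) := by
  simp [mixDensity, hz]

lemma mixDensity_of_notMem {a : ℝ} {z : Ω2} (hz : z ∉ lowerBranch) :
    mixDensity a z = ENNReal.ofReal (2 * (1 - a)) := by
  simp [mixDensity, hz]

lemma xi11_lowerBranch : xi11 lowerBranch = 1 :=
  (prob_compl_eq_zero_iff measurableSet_lowerBranch).1 ae_mem_lowerBranch

lemma xi22_lowerBranch : xi22 lowerBranch = 0 := by
  simpa [ae_iff] using ae_mem_upperBranch.mono fun z => disjoint_branches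

lemma withDensity_mixDensity (a : ℝ) : xiM.withDensity (mixDensity a) = mixXi a := by
  have h₁ : xiM.restrict lowerBranch = (2⁻¹ : ℝ≥0∞) • xi11 := by
    rw [xiM, Measure.restrict_add, Measure.restrict_smul, Measure.restrict_smul,
      Measure.restrict_eq_self_of_ae_mem ae_mem_lowerBranch,
      Measure.restrict_eq_zero.2 xi22_lowerBranch, smul_zero, add_zero]
  have h₂ : xiM.restrict lowerBranchᶜ = (2⁻¹ : ℝ≥0∞) • xi22 := by
    rw [xiM, Measure.restrict_add, Measure.restrict_smul, Measure.restrict_smul,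
      Measure.restrict_eq_self_of_ae_mem (μ := xi22) (s := lowerBranchᶜ)
        (ae_mem_upperBranch.mono fun z => disjoint_branches),
      Measure.restrict_eq_zero.2 ((prob_compl_eq_zero_iff measurableSet_lowerBranch).2
        xi11_lowerBranch), smul_zero, zero_add]
  have h₃ (b : ℝ) : ENNReal.ofReal (2 * b) * 2⁻¹ = ENNReal.ofReal b := by
    rw [ENNReal.ofReal_mul (by norm_num), ENNReal.ofReal_ofNat, mul_comm, ← mul_assoc,
      ENNReal.inv_mul_cancel (by simp) (by simp), one_mul]
  rw [mixDensity, withDensity_add_left (measurable_const.indicator measurableSet_lowerBranch),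
    withDensity_indicator measurableSet_lowerBranch,
    withDensity_indicator measurableSet_lowerBranch.compl, withDensity_const, withDensity_const,
    h₁, h₂, smul_smul, smul_smul, h₃, h₃, mixXi]

lemma mixXi_absolutelyContinuous (a : ℝ) : mixXi a ≪ xiM :=
  withDensity_mixDensity a ▸ withDensity_absolutelyContinuous _ _

lemma mixXi_real_lowerBranch {a : ℝ} (ha : 0 ≤ a) : (mixXi a).real lowerBranch = a := by
  simp [mixXi, measureReal_def, xi11_lowerBranch, xi22_lowerBranch, ha]

lemma xiM_real_lowerBranch : xiM.real lowerBranch = 1/2 := by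
  rw [xiM_eq_mixXi, mixXi_real_lowerBranch (by norm_num)]

/-! ### The relative entropy with respect to `ξ` -/

lemma KL_mixXi {a : ℝ} (ha : 0 ≤ a) (ha' : a ≤ 1) :
    KL (mixXi a) xiM
      = ENNReal.ofReal (a * Real.log (2 * a) + (1 - a) * Real.log (2 * (1 - a))) := by
  classical
  have hd : (mixXi a).rnDeriv xiM =ᵐ[xiM] mixDensity a := by
    rw [← withDensity_mixDensity]
    exact Measure.rnDeriv_withDensity _ (measurable_mixDensity a)
  have hk : ∀ᵐ z ∂xiM, ENNReal.ofReal (((mixXi a).rnDeriv xiM z).toReal *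
      Real.log (((mixXi a).rnDeriv xiM z).toReal) + 1 - ((mixXi a).rnDeriv xiM z).toReal)
      = ENNReal.ofReal (if z ∈ lowerBranch then InformationTheory.klFun (2 * a)
        else InformationTheory.klFun (2 * (1 - a))) := by
    filter_upwards [hd] with z hz
    rw [hz]
    split_ifs with h
    · rw [mixDensity_of_mem h, ENNReal.toReal_ofReal (by linarith), InformationTheory.klFun_apply]
    · rw [mixDensity_of_notMem h, ENNReal.toReal_ofReal (by linarith),
        InformationTheory.klFun_apply]
  rw [KL, if_pos (mixXi_absolutelyContinuous a), lintegral_congr_ae hk,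
    ← ofReal_integral_eq_lintegral_ofReal, integral_ite_lowerBranch, xiM_real_lowerBranch]
  · congr 1
    simp only [InformationTheory.klFun_apply]
    ring
  · refine Integrable.piecewise (s := lowerBranch) (f := fun _ => InformationTheory.klFun (2 * a))
      (g := fun _ => InformationTheory.klFun (2 * (1 - a))) measurableSet_lowerBranch ?_ ?_ <;>
      exact integrableOn_const (measure_ne_top _ _)
  · refine .of_forall fun z => ?_
    simp only [Pi.zero_apply]
    split_ifs <;> exact InformationTheory.klFun_nonneg (by linarith)

lemma KL_lower_bound {ν : Measure Ω2} [IsProbabilityMeasure ν] (h : ν ≪ xiM)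
    (hKL : KL ν xiM ≠ ∞) {a : ℝ} (ha : 0 < a) (ha' : a < 1) :
    ∃ k : ℝ, KL ν xiM = ENNReal.ofReal k ∧
      ν.real lowerBranch * Real.log (2 * a)
        + (1 - ν.real lowerBranch) * Real.log (2 * (1 - a)) ≤ k ∧
      (k = ν.real lowerBranch * Real.log (2 * a)
        + (1 - ν.real lowerBranch) * Real.log (2 * (1 - a)) → ν = mixXi a) := by
  classical
  set g : Ω2 → ℝ := fun z => (ν.rnDeriv xiM z).toReal with hg
  set c : Ω2 → ℝ := fun z => if z ∈ lowerBranch then 2 * a else 2 * (1 - a) with hc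
  have hc_pos (z : Ω2) : 0 < c z := by
    simp only [hc]
    split_ifs <;> linarith
  have hg_nonneg (z : Ω2) : 0 ≤ g z := ENNReal.toReal_nonneg
  have hg_meas : Measurable g := (Measure.measurable_rnDeriv ν xiM).ennreal_toReal
  have hg_int : Integrable g xiM := Measure.integrable_toReal_rnDeriv
  have hKL_eq : KL ν xiM = ∫⁻ z, ENNReal.ofReal (InformationTheory.klFun (g z)) ∂xiM := by
    rw [KL, if_pos h]
    rfl
  have hφ_nonneg (z : Ω2) : 0 ≤ InformationTheory.klFun (g z) :=
    InformationTheory.klFun_nonneg (hg_nonneg z)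
  have hφ_int : Integrable (fun z => InformationTheory.klFun (g z)) xiM := by
    refine (lintegral_ofReal_ne_top_iff_integrable
      (InformationTheory.measurable_klFun.comp hg_meas).aestronglyMeasurable
      (.of_forall hφ_nonneg)).1 ?_
    exact hKL_eq ▸ hKL
  have hlin_int : Integrable (fun z => (if z ∈ lowerBranch then 2 * a - 1 else 2 * (1 - a) - 1))
      xiM := by
    refine Integrable.piecewise (s := lowerBranch) (f := fun _ => 2 * a - 1)
      (g := fun _ => 2 * (1 - a) - 1) measurableSet_lowerBranch ?_ ?_ <;>
      exact integrableOn_const (measure_ne_top _ _)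
  have hlog_int : Integrable (fun z => g z *
      (if z ∈ lowerBranch then Real.log (2 * a) else Real.log (2 * (1 - a)))) xiM := by
    have : (fun z => g z *
        (if z ∈ lowerBranch then Real.log (2 * a) else Real.log (2 * (1 - a)))) =
        lowerBranch.piecewise (fun z => g z * Real.log (2 * a))
          (fun z => g z * Real.log (2 * (1 - a))) := by
      ext z
      by_cases hz : z ∈ lowerBranch <;> simp [hz]
    rw [this]
    exact Integrable.piecewise measurableSet_lowerBranch (hg_int.mul_const _).integrableOn
      (hg_int.mul_const _).integrableOn
  have hD (z : Ω2) : c z * InformationTheory.klFun (g z / c z) =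
      (InformationTheory.klFun (g z) + (if z ∈ lowerBranch then 2 * a - 1 else 2 * (1 - a) - 1)) -
      g z * (if z ∈ lowerBranch then Real.log (2 * a) else Real.log (2 * (1 - a))) := by
    have h₁ : (if z ∈ lowerBranch then 2 * a - 1 else 2 * (1 - a) - 1) = c z - 1 := by
      simp only [hc]
      split_ifs <;> rfl
    have h₂ : (if z ∈ lowerBranch then Real.log (2 * a) else Real.log (2 * (1 - a)))
        = Real.log (c z) := by
      simp only [hc]
      split_ifs <;> rfl
    rw [h₁, h₂, InformationTheory.klFun_apply, InformationTheory.klFun_apply]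
    rcases (hg_nonneg z).eq_or_lt with h0 | h0
    · rw [← h0]
      simp
    · rw [Real.log_div h0.ne' (hc_pos z).ne']
      have := (hc_pos z).ne'
      field_simp
      ring
  have hD_nonneg (z : Ω2) : 0 ≤ c z * InformationTheory.klFun (g z / c z) :=
    mul_nonneg (hc_pos z).le
      (InformationTheory.klFun_nonneg (div_nonneg (hg_nonneg z) (hc_pos z).le))
  have hD_int : Integrable (fun z => c z * InformationTheory.klFun (g z / c z)) xiM := by
    simp only [hD]
    exact (hφ_int.add hlin_int).sub hlog_int
  have hlog : ∫ z, g z * (if z ∈ lowerBranch then Real.log (2 * a) else Real.log (2 * (1 - a)))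
      ∂xiM = ν.real lowerBranch * Real.log (2 * a)
        + (1 - ν.real lowerBranch) * Real.log (2 * (1 - a)) := by
    rw [← integral_ite_lowerBranch]
    exact integral_rnDeriv_smul h
  have hD_eq : ∫ z, c z * InformationTheory.klFun (g z / c z) ∂xiM =
      ∫ z, InformationTheory.klFun (g z) ∂xiM - (ν.real lowerBranch * Real.log (2 * a)
        + (1 - ν.real lowerBranch) * Real.log (2 * (1 - a))) := by
    simp only [hD]
    have h₁ := integral_sub (hφ_int.add hlin_int) hlog_int
    simp only [Pi.add_apply] at h₁
    rw [h₁, integral_add hφ_int hlin_int, hlog, integral_ite_lowerBranch, xiM_real_lowerBranch]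
    ring
  refine ⟨∫ z, InformationTheory.klFun (g z) ∂xiM, ?_, ?_, fun hk => ?_⟩
  · rw [hKL_eq, ofReal_integral_eq_lintegral_ofReal hφ_int (.of_forall hφ_nonneg)]
  · have := integral_nonneg_of_ae (μ := xiM) (.of_forall hD_nonneg)
    linarith
  · rw [hk, sub_self, integral_eq_zero_iff_of_nonneg hD_nonneg hD_int] at hD_eq
    rw [← withDensity_mixDensity, ← Measure.withDensity_rnDeriv_eq ν xiM h]
    refine withDensity_congr_ae ?_
    filter_upwards [hD_eq, Measure.rnDeriv_ne_top ν xiM] with z hz hz_top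
    have h₁ : g z = c z := by
      have := (mul_eq_zero.1 hz).resolve_left (hc_pos z).ne'
      rwa [InformationTheory.klFun_eq_zero_iff (div_nonneg (hg_nonneg z) (hc_pos z).le),
        div_eq_one_iff_eq (hc_pos z).ne'] at this
    rw [← ENNReal.ofReal_toReal hz_top]
    change ENNReal.ofReal (g z) = _
    rw [h₁]
    by_cases hL : z ∈ lowerBranch
    · simp [hc, hL, mixDensity_of_mem]
    · simp [hc, hL, mixDensity_of_notMem]

/-! ### The constrained minimization problem -/

/-- A measure of relative entropy at most that of `mixXi a` and charging the lower branch at least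
as much as `mixXi a` equals `mixXi a`. -/
lemma eq_mixXi_of_KL_le {ν : Measure Ω2} [IsProbabilityMeasure ν] (h : ν ≪ xiM)
    {a : ℝ} (ha : 0 < a) (ha' : a < 1)
    (hp : 0 ≤ (ν.real lowerBranch - a) * (Real.log (2 * a) - Real.log (2 * (1 - a))))
    (hle : KL ν xiM ≤ KL (mixXi a) xiM) : ν = mixXi a := by
  have hmix := KL_mixXi ha.le ha'.le
  have htop : KL ν xiM ≠ ∞ := ne_top_of_le_ne_top (hmix ▸ ENNReal.ofReal_ne_top) hle
  obtain ⟨k, hk, hge, heq⟩ := KL_lower_bound h htop ha ha'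
  have hK : 0 ≤ a * Real.log (2 * a) + (1 - a) * Real.log (2 * (1 - a)) := by
    have h₁ := InformationTheory.klFun_nonneg (x := 2 * a) (by linarith)
    have h₂ := InformationTheory.klFun_nonneg (x := 2 * (1 - a)) (by linarith)
    rw [InformationTheory.klFun_apply] at h₁ h₂
    linarith
  rw [hmix, hk, ENNReal.ofReal_le_ofReal_iff hK] at hle
  exact heq (by linarith)

lemma KL_mixXi_one_sub {a : ℝ} (ha : 0 ≤ a) (ha' : a ≤ 1) :
    KL (mixXi (1 - a)) xiM = KL (mixXi a) xiM := by
  rw [KL_mixXi ha ha', KL_mixXi (by linarith) (by linarith)]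
  congr 1
  rw [sub_sub_cancel]
  ring

lemma absolutelyContinuous_of_KL_ne_top {ν μ : Measure Ω2} (h : KL ν μ ≠ ∞) : ν ≪ μ := by
  by_contra hν
  exact h (if_neg hν)

lemma tPat_inv2_mixXi {a : ℝ} (ha : 0 ≤ a) (ha' : a ≤ 1) :
    tPat inv2 (mixXi a) = a ^ 2 + (1 - a) ^ 2 := by
  have := isProbabilityMeasure_mixXi ha ha'
  rw [tPat_inv2_eq (mixXi_absolutelyContinuous a), mixXi_real_lowerBranch ha]

lemma eq_mixXi_of_tPat_ge {a : ℝ} (ha : 1/2 < a) (ha' : a < 1) {ν : Measure Ω2}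
    [IsProbabilityMeasure ν] (ht : a ^ 2 + (1 - a) ^ 2 ≤ tPat inv2 ν)
    (hle : KL ν xiM ≤ KL (mixXi a) xiM) : ν = mixXi a ∨ ν = mixXi (1 - a) := by
  have h : ν ≪ xiM := absolutelyContinuous_of_KL_ne_top <| ne_top_of_le_ne_top
    (KL_mixXi (by linarith) ha'.le ▸ ENNReal.ofReal_ne_top) hle
  rw [tPat_inv2_eq h] at ht
  have hlog : Real.log (2 * (1 - a)) ≤ Real.log (2 * a) :=
    Real.log_le_log (by linarith) (by linarith)
  rcases le_or_gt a (ν.real lowerBranch) with hp | hp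
  · exact Or.inl (eq_mixXi_of_KL_le h (by linarith) ha'
      (mul_nonneg (by linarith) (by linarith)) hle)
  · have hp' : ν.real lowerBranch ≤ 1 - a := by nlinarith
    refine Or.inr (eq_mixXi_of_KL_le h (by linarith) (by linarith) ?_ ?_)
    · rw [sub_sub_cancel]
      exact mul_nonneg_of_nonpos_of_nonpos (by linarith) (by linarith)
    · rwa [KL_mixXi_one_sub (by linarith) ha'.le]

lemma Gfun_eq {a : ℝ} (ha : 1/2 < a) (ha' : a < 1) :
    Gfun inv2 xiM (a ^ 2 + (1 - a) ^ 2) = KL (mixXi a) xiM := by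
  have hprob := isProbabilityMeasure_mixXi (a := a) (by linarith) ha'.le
  refine le_antisymm (iInf₂_le (⟨mixXi a, hprob⟩ : ProbabilityMeasure Ω2)
    ⟨mem_Mcal_of_absolutelyContinuous (mixXi_absolutelyContinuous a),
      (tPat_inv2_mixXi (by linarith) ha'.le).ge⟩) (le_iInf₂ fun ν hν => ?_)
  by_contra! hlt
  rcases eq_mixXi_of_tPat_ge ha ha' hν.2 hlt.le with h | h
  · rw [h] at hlt
    exact hlt.false
  · rw [h, KL_mixXi_one_sub (by linarith) ha'.le] at hlt
    exact hlt.false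

lemma Gset_eq {a : ℝ} (ha : 1/2 < a) (ha' : a < 1) :
    Gset inv2 xiM (a ^ 2 + (1 - a) ^ 2) = {ν : ProbabilityMeasure Ω2 |
      (ν : Measure Ω2) = mixXi a ∨ (ν : Measure Ω2) = mixXi (1 - a)} := by
  ext ν
  simp only [Gset, Set.mem_ofPred_eq, Gfun_eq ha ha']
  refine ⟨fun h => eq_mixXi_of_tPat_ge ha ha' h.1.2 h.2.le, ?_⟩
  rintro (h | h)
  · refine ⟨⟨mem_Mcal_of_absolutelyContinuous (h ▸ mixXi_absolutelyContinuous a), ?_⟩, by rw [h]⟩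
    rw [h, tPat_inv2_mixXi (by linarith) ha'.le]
  · refine ⟨⟨mem_Mcal_of_absolutelyContinuous (h ▸ mixXi_absolutelyContinuous _), ?_⟩,
      by rw [h, KL_mixXi_one_sub (by linarith) ha'.le]⟩
    rw [h, tPat_inv2_mixXi (by linarith) (by linarith), sub_sub_cancel, add_comm]

lemma alphaSig_xiM : alphaSig inv2 xiM = 1 := by
  have h : {δ : ℝ | Gfun inv2 xiM δ = ∞} = Set.Ioi 1 := by
    ext δ
    refine ⟨fun hδ => ?_, fun hδ => ?_⟩
    · refine Set.mem_Ioi.2 (not_le.1 fun hle => ?_)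
      have hprob := isProbabilityMeasure_mixXi (a := 1) zero_le_one le_rfl
      have hG : Gfun inv2 xiM δ ≤ KL (mixXi 1) xiM :=
        iInf₂_le (⟨mixXi 1, hprob⟩ : ProbabilityMeasure Ω2)
          ⟨mem_Mcal_of_absolutelyContinuous (mixXi_absolutelyContinuous 1), by
            rw [ProbabilityMeasure.coe_mk, tPat_inv2_mixXi zero_le_one le_rfl]
            linarith⟩
      rw [KL_mixXi zero_le_one le_rfl] at hG
      exact ne_top_of_le_ne_top ENNReal.ofReal_ne_top hG hδ
    · refine iInf₂_eq_top.2 fun ν hν => ?_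
      exact absurd (hν.2.trans (tPat_le_one _ _)) (not_le.2 hδ)
  rw [alphaSig, h, csInf_Ioi]

lemma isCC_xiM : IsCC (k := 1) inv2 xiM := by
  classical
  refine ⟨1/2, by norm_num, ?_⟩
  filter_upwards [ae_measureReal_inversions (ν := xiM) .rfl] with z hz
  have h : ∫ w : Fin 1 → Ω2, hPat inv2 (Fin.cons z w) ∂pmeas xiM 1
      = xiM.real {w | (z, w) ∈ inversionSet} := by
    change _ = xiM.real (Prod.mk z ⁻¹' inversionSet)
    rw [← integral_indicator_one (measurable_prodMk_left measurableSet_inversionSet),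
      ← (measurePreserving_funUnique xiM (Fin 1)).integral_comp
        (MeasurableEquiv.measurableEmbedding _)]
    simp only [hPat_inv2]
    rfl
  rw [h, hz, xiM_real_lowerBranch]
  split_ifs <;> norm_num

/-! ### The normalized minimizers -/

section
variable {ν : Measure Ω2} [IsProbabilityMeasure ν]

open scoped Classical in
lemma ae_cdf_add_cdf (h : ν ≪ xiM) :
    ∀ᵐ z ∂ν, cdfX ν z.1 + cdfY ν z.2 =
      if z ∈ lowerBranch then ν.real lowerBranch else 1 + ν.real lowerBranch := by
  filter_upwards [h.ae_le ae_mem_branches] with z hz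
  have hsum : cdfX ν z.1 + cdfY ν z.2 =
      ν.real ({p | p.1 ≤ z.1} ∪ {p | p.2 ≤ z.2}) + ν.real ({p | p.1 ≤ z.1} ∩ {p | p.2 ≤ z.2}) :=
    (measureReal_union_add_inter (measurableSet_le measurable_snd measurable_const)).symm
  rw [hsum]
  by_cases hL : z ∈ lowerBranch
  · obtain ⟨a1, a2, a3⟩ := id hL
    have h₁ : ν.real ({p | p.1 ≤ z.1} ∪ {p | p.2 ≤ z.2}) = ν.real lowerBranch := by
      refine measureReal_congr ?_
      filter_upwards [h.ae_le ae_mem_branches] with w hw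
      refine propext ⟨fun hi => hw.resolve_right fun ⟨b1, b2, b3⟩ => ?_, fun ⟨b1, b2, b3⟩ => ?_⟩
      · rcases hi with c | c <;> simp only [Set.mem_ofPred_eq] at c <;> linarith
      · rcases le_total w.1 z.1 with c | c
        · exact Or.inl c
        · exact Or.inr (show w.2 ≤ z.2 by linarith)
    have h₂ : ν.real ({p | p.1 ≤ z.1} ∩ {p | p.2 ≤ z.2}) = ν.real (∅ : Set Ω2) := by
      refine measureReal_congr ?_
      filter_upwards [h.ae_le ae_mem_branches, h.ae_le (ae_fst_ne z.1)] with w hw hne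
      refine propext ⟨fun ⟨c, d⟩ => hne (le_antisymm c ?_), fun hi => hi.elim⟩
      simp only [Set.mem_ofPred_eq] at c d
      rcases hw with ⟨b1, b2, b3⟩ | ⟨b1, b2, b3⟩ <;> linarith
    rw [h₁, h₂, if_pos hL, measureReal_empty, add_zero]
  · obtain ⟨a1, a2, a3⟩ := hz.resolve_left hL
    have h₁ : ν.real ({p | p.1 ≤ z.1} ∪ {p | p.2 ≤ z.2}) = ν.real Set.univ := by
      refine measureReal_congr ?_
      filter_upwards [h.ae_le ae_mem_branches] with w hw
      refine propext ⟨fun _ => trivial, fun _ => ?_⟩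
      rcases le_total w.1 z.1 with c | c
      · exact Or.inl c
      · refine Or.inr (show w.2 ≤ z.2 from ?_)
        rcases hw with ⟨b1, b2, b3⟩ | ⟨b1, b2, b3⟩ <;> linarith
    have h₂ : ν.real ({p | p.1 ≤ z.1} ∩ {p | p.2 ≤ z.2}) = ν.real lowerBranch := by
      refine measureReal_congr ?_
      filter_upwards [h.ae_le ae_mem_branches, h.ae_le (ae_fst_ne z.1)] with w hw hne
      refine propext ⟨fun ⟨c, d⟩ => hw.resolve_right fun ⟨b1, b2, b3⟩ => hne (le_antisymm c ?_),
        fun ⟨b1, b2, b3⟩ => ⟨show w.1 ≤ z.1 by linarith, show w.2 ≤ z.2 by linarith⟩⟩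
      simp only [Set.mem_ofPred_eq] at c d
      linarith
    rw [h₁, h₂, if_neg hL, probReal_univ]

lemma measurable_cdfX : Measurable (cdfX ν) :=
  Monotone.measurable fun _ _ hxy =>
    measureReal_mono (μ := ν) fun _ hp => le_trans hp.out hxy

lemma measurable_cdfY : Measurable (cdfY ν) :=
  Monotone.measurable fun _ _ hxy =>
    measureReal_mono (μ := ν) fun _ hp => le_trans hp.out hxy

lemma Omap_antidiagonal (c : ℝ) :
    Omap ν {q | q.1 + q.2 = c} = ν {z | cdfX ν z.1 + cdfY ν z.2 = c} :=
  Measure.map_apply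
    ((measurable_cdfX.comp measurable_fst).prodMk (measurable_cdfY.comp measurable_snd))
    (measurableSet_eq_fun (by fun_prop) measurable_const)

lemma Omap_antidiagonal_ne_zero (h : ν ≪ xiM) (hp : 0 < ν.real lowerBranch) :
    Omap ν {q | q.1 + q.2 = ν.real lowerBranch} ≠ 0 := by
  rw [Omap_antidiagonal]
  intro h0
  have h₁ : ∀ᵐ z ∂ν, ¬ cdfX ν z.1 + cdfY ν z.2 = ν.real lowerBranch := by
    simpa [ae_iff] using h0
  have h₂ : ∀ᵐ z ∂ν, z ∉ lowerBranch := by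
    filter_upwards [h₁, ae_cdf_add_cdf h] with z hz hz' hL
    exact hz (hz'.trans (if_pos hL))
  have h₃ : ν lowerBranch = 0 := by simpa [ae_iff] using ae_iff.1 h₂
  simp [measureReal_def, h₃] at hp

lemma Omap_antidiagonal_eq_zero (h : ν ≪ xiM) {c : ℝ} (hc : c ≠ ν.real lowerBranch)
    (hc' : c ≠ 1 + ν.real lowerBranch) : Omap ν {q | q.1 + q.2 = c} = 0 := by
  rw [Omap_antidiagonal]
  have h₁ : ∀ᵐ z ∂ν, ¬ cdfX ν z.1 + cdfY ν z.2 = c := by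
    filter_upwards [ae_cdf_add_cdf h] with z hz
    rw [hz]
    split_ifs
    exacts [hc.symm, hc'.symm]
  simpa using ae_iff.1 h₁

end

lemma Omap_mixXi_ne {a : ℝ} (ha : 1/2 < a) (ha' : a < 1) :
    Omap (mixXi a) ≠ Omap (mixXi (1 - a)) := by
  have := isProbabilityMeasure_mixXi (a := a) (by linarith) ha'.le
  have := isProbabilityMeasure_mixXi (a := 1 - a) (by linarith) (by linarith)
  have hp := mixXi_real_lowerBranch (a := a) (by linarith)
  have hq := mixXi_real_lowerBranch (a := 1 - a) (by linarith)
  intro heq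
  refine Omap_antidiagonal_ne_zero (mixXi_absolutelyContinuous a) (by linarith) ?_
  rw [heq]
  exact Omap_antidiagonal_eq_zero (mixXi_absolutelyContinuous _)
    (fun h => by linarith) (fun h => by linarith)

/-- Proposition 1.17: `ξ` is CC with respect to `21`, `t_{21}(ξ) = 1/2`,
`α_{21}(ξ) = 1`, and for every `δ ∈ (1/2,1)` the set `𝒢(21,ξ,δ)` consists of the two
mixtures with coefficients `(1 ± √(2δ−1))/2`; moreover `𝒪(𝒢(21,ξ,δ))` has exactly two
elements. -/
theorem minimizers_for_xi :
    IsCC (k := 1) inv2 xiM ∧ tPat inv2 xiM = 1/2 ∧ alphaSig inv2 xiM = 1 ∧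
    ∀ δ ∈ Set.Ioo (1/2 : ℝ) 1,
      Gset inv2 xiM δ = {ν : ProbabilityMeasure Ω2 |
          (ν : Measure Ω2) =
            ENNReal.ofReal ((1 + Real.sqrt (2*δ - 1))/2) • xi11 +
              ENNReal.ofReal ((1 - Real.sqrt (2*δ - 1))/2) • xi22 ∨
          (ν : Measure Ω2) =
            ENNReal.ofReal ((1 - Real.sqrt (2*δ - 1))/2) • xi11 +
              ENNReal.ofReal ((1 + Real.sqrt (2*δ - 1))/2) • xi22} ∧
      ∃ m₁ m₂ : Measure Ω2, m₁ ≠ m₂ ∧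
        (fun ν : ProbabilityMeasure Ω2 => Omap (↑ν)) '' Gset inv2 xiM δ = {m₁, m₂} := by
  refine ⟨isCC_xiM, ?_, alphaSig_xiM, fun δ hδ => ?_⟩
  · rw [tPat_inv2_eq .rfl, xiM_real_lowerBranch]
    norm_num
  · set s := Real.sqrt (2 * δ - 1) with hs
    have hs_sq : s ^ 2 = 2 * δ - 1 := Real.sq_sqrt (by linarith [hδ.1])
    have hs_pos : 0 < s := Real.sqrt_pos.2 (by linarith [hδ.1])
    have hs_lt : s < 1 := by nlinarith [hδ.2]
    have ha : 1/2 < (1 + s) / 2 := by linarith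
    have ha' : (1 + s) / 2 < 1 := by linarith
    have hb : 1 - (1 + s) / 2 = (1 - s) / 2 := by ring
    have hb' : 1 - (1 - s) / 2 = (1 + s) / 2 := by ring
    have hδ_eq : δ = ((1 + s) / 2) ^ 2 + (1 - (1 + s) / 2) ^ 2 := by linear_combination -hs_sq / 2
    have hG := Gset_eq ha ha'
    rw [← hδ_eq] at hG
    refine ⟨by simpa only [mixXi, hb, hb'] using hG, _, _, Omap_mixXi_ne ha ha', ?_⟩
    rw [hG]
    ext m
    constructor
    · rintro ⟨ν, hν | hν, rfl⟩
      · exact Or.inl (congrArg Omap hν)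
      · exact Or.inr (congrArg Omap hν)
    · rintro (rfl | rfl)
      · exact ⟨⟨_, isProbabilityMeasure_mixXi (by linarith) ha'.le⟩, Or.inl rfl, rfl⟩
      · exact ⟨⟨_, isProbabilityMeasure_mixXi (by linarith) (by linarith)⟩, Or.inr rfl, rfl⟩

end
end

section
/- Let 21 ∈ S_2 denote the inversion pattern. If μ ∈ ℳ is CC with respect to 21, then there exists a constant c ∈ [0,1] such that for every (x,y) ∈ supp(μ), μ([0,x]×[0,y]) + μ([x,1]×[y,1]) = c. -/
open MeasureTheory Filter Topology
open scoped ENNReal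

noncomputable section

/-- The points forming an inversion with `p`. -/
def discordantSet (p : Ω2) : Set Ω2 :=
  {q | (p.1 < q.1 ∧ q.2 < p.2) ∨ (q.1 < p.1 ∧ p.2 < q.2)}

lemma measurableSet_discordantSet (p : Ω2) : MeasurableSet (discordantSet p) := by
  unfold discordantSet
  measurability

lemma hPat_inv2_s19 (p : Ω2) (w : Fin 1 → Ω2) :
    hPat inv2 (Fin.cons p w) = (discordantSet p).indicator (fun _ => (1 : ℝ)) (w 0) := by
  classical
  have h : (∃ τ : Equiv.Perm (Fin 2),
      StrictMono (fun i => ((Fin.cons p w : Fin 2 → Ω2) (τ i)).1) ∧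
        StrictMono (fun i => ((Fin.cons p w : Fin 2 → Ω2) (τ (inv2⁻¹ i))).2)) ↔
      w 0 ∈ discordantSet p := by
    have hinv : inv2⁻¹ = Equiv.swap 0 1 := Equiv.swap_inv 0 1
    simp only [Fin.strictMono_iff_lt_succ, hinv]
    constructor
    · rintro ⟨τ, h₁, h₂⟩
      have h₁ := h₁ 0
      have h₂ := h₂ 0
      obtain rfl | rfl : τ = 1 ∨ τ = Equiv.swap 0 1 := by
        clear * - τ
        decide +revert
      · left; simpa using And.intro h₁ h₂
      · right; simpa using And.intro h₁ h₂
    · rintro (h | h)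
      · exact ⟨1, by simpa using h.1, by simpa using h.2⟩
      · exact ⟨Equiv.swap 0 1, by simpa using h.1, by simpa using h.2⟩
  simp only [hPat, Set.indicator, h]

lemma integral_hPat_inv2 (μ : Measure Ω2) [IsProbabilityMeasure μ] (p : Ω2) :
    ∫ w : Fin 1 → Ω2, hPat inv2 (Fin.cons p w) ∂pmeas μ 1 = μ.real (discordantSet p) := by
  simp only [hPat_inv2_s19]
  rw [← integral_indicator_one (measurableSet_discordantSet p)]
  exact (measurePreserving_funUnique μ (Fin 1)).integral_comp'
    (g := (discordantSet p).indicator fun _ => (1 : ℝ))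

lemma continuous_measureReal_discordantSet (μ : Measure Ω2) [IsProbabilityMeasure μ]
    (hfst : ∀ x, ∀ᵐ q ∂μ, q.1 ≠ x) (hsnd : ∀ y, ∀ᵐ q ∂μ, q.2 ≠ y) :
    Continuous fun p => μ.real (discordantSet p) := by
  simp only [← integral_indicator_one (measurableSet_discordantSet _)]
  refine continuous_iff_continuousAt.2 fun p => ?_
  refine continuousAt_of_dominated (bound := fun _ => 1) (.of_forall fun p' => ?_)
    (.of_forall fun p' => .of_forall fun q => ?_) (integrable_const _) ?_
  · exact (measurable_one.indicator (measurableSet_discordantSet p')).aestronglyMeasurable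
  · by_cases h : q ∈ discordantSet p' <;> simp [h]
  · filter_upwards [hfst p.1, hsnd p.2] with q h₁ h₂
    have side : ∀ {f : Ω2 → ℝ} {a : ℝ}, Continuous f → a ≠ f p →
        ∀ᶠ p' in 𝓝 p, (a < f p' ↔ a < f p) ∧ (f p' < a ↔ f p < a) := by
      intro f a hf ha
      rcases ha.lt_or_gt with h | h
      · filter_upwards [hf.continuousAt.eventually (lt_mem_nhds h)] with p' h'
        grind
      · filter_upwards [hf.continuousAt.eventually (gt_mem_nhds h)] with p' h'
        grind
    refine ContinuousAt.congr (f := fun _ => (discordantSet p).indicator 1 q)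
      continuousAt_const ?_
    filter_upwards [side continuous_fst h₁, side continuous_snd h₂] with p' h h'
    have hmem : q ∈ discordantSet p' ↔ q ∈ discordantSet p := by
      simp [discordantSet, h, h']
    by_cases hq : q ∈ discordantSet p <;> simp [hq, hmem]

lemma corner_mass_eq (μ : Measure Ω2) [IsProbabilityMeasure μ] (hsq : ∀ᵐ q ∂μ, q ∈ unitSq)
    (hfst : ∀ x, ∀ᵐ q ∂μ, q.1 ≠ x) (hsnd : ∀ y, ∀ᵐ q ∂μ, q.2 ≠ y) (p : Ω2) :
    μ (Set.Icc 0 p.1 ×ˢ Set.Icc 0 p.2) + μ (Set.Icc p.1 1 ×ˢ Set.Icc p.2 1) =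
      μ (discordantSet p)ᶜ := by
  have hdisj : AEDisjoint μ (Set.Icc 0 p.1 ×ˢ Set.Icc 0 p.2) (Set.Icc p.1 1 ×ˢ Set.Icc p.2 1) := by
    refine measure_mono_null (fun q hq => ?_) (ae_iff.1 (hfst p.1))
    simpa using le_antisymm hq.1.1.2 hq.2.1.1
  rw [← measure_union₀ (measurableSet_Icc.prod measurableSet_Icc).nullMeasurableSet hdisj]
  refine measure_congr ?_
  filter_upwards [hsq, hfst p.1, hsnd p.2] with q hq h₁ h₂
  obtain ⟨⟨h₃, h₄⟩, h₅, h₆⟩ := hq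
  refine propext ?_
  change (((0 ≤ q.1 ∧ q.1 ≤ p.1) ∧ (0 ≤ q.2 ∧ q.2 ≤ p.2)) ∨
    ((p.1 ≤ q.1 ∧ q.1 ≤ 1) ∧ (p.2 ≤ q.2 ∧ q.2 ≤ 1))) ↔
    ¬((p.1 < q.1 ∧ q.2 < p.2) ∨ (q.1 < p.1 ∧ p.2 < q.2))
  grind

/-- A continuous function that is a.e. constant takes that constant value on the support. -/
lemma eq_of_mem_msupport {μ : Measure Ω2} {f : Ω2 → ℝ} {c : ℝ} (hf : Continuous f)
    (h : ∀ᵐ q ∂μ, f q = c) {p : Ω2} (hp : p ∈ msupport μ) : f p = c := by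
  by_contra hne
  exact (hp {q | f q ≠ c} (isOpen_ne_fun hf continuous_const) hne).ne' (ae_iff.1 h)

/-- Lemma 5.2: if `μ ∈ ℳ` is CC with respect to `21`, then there is a
constant `c ∈ [0,1]` such that `μ([0,x]×[0,y]) + μ([x,1]×[y,1]) = c` for every `(x,y)` in
the support of `μ`. -/
theorem cc_corner_mass_constant (μ : ProbabilityMeasure Ω2) (hμ : μ ∈ Mcal)
    (hcc : IsCC (k := 1) inv2 (↑μ)) :
    ∃ c : ℝ≥0∞, c ≤ 1 ∧ ∀ p ∈ msupport ((↑μ : Measure Ω2)),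
      (↑μ : Measure Ω2) (Set.Icc 0 p.1 ×ˢ Set.Icc 0 p.2) +
        (↑μ : Measure Ω2) (Set.Icc p.1 1 ×ˢ Set.Icc p.2 1) = c := by
  obtain ⟨hsq, hfst, hsnd⟩ := hμ
  have hsq : ∀ᵐ q ∂(μ : Measure Ω2), q ∈ unitSq :=
    mem_ae_iff_prob_eq_one (measurableSet_Icc.prod measurableSet_Icc) |>.2 hsq
  have hfst (x : ℝ) : ∀ᵐ q ∂(μ : Measure Ω2), q.1 ≠ x := by
    have h := hfst x
    rw [Measure.map_apply measurable_fst (measurableSet_singleton x)] at h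
    exact measure_eq_zero_iff_ae_notMem.1 h
  have hsnd (y : ℝ) : ∀ᵐ q ∂(μ : Measure Ω2), q.2 ≠ y := by
    have h := hsnd y
    rw [Measure.map_apply measurable_snd (measurableSet_singleton y)] at h
    exact measure_eq_zero_iff_ae_notMem.1 h
  obtain ⟨c, hc, hae⟩ := hcc
  simp only [integral_hPat_inv2] at hae
  refine ⟨ENNReal.ofReal (1 - c), by simpa using hc.1, fun p hp => ?_⟩
  rw [corner_mass_eq _ hsq hfst hsnd, ← ofReal_measureReal,
    probReal_compl_eq_one_sub (measurableSet_discordantSet p),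
    eq_of_mem_msupport (continuous_measureReal_discordantSet _ hfst hsnd) hae hp]

end
end
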